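/- Let z₁, ..., z_N be samples from a stationary finite-state Markov chain, f(w; ·): Ω → ℝ^d with ‖∇f(w; z)‖ ≤ G for all z, F(w) = E_{z~μ}[∇f(w;z)] (the stationary mean). Fix K ∈ [N] and n = ⌊N/K⌋. Then for every δ > K(n−1)d_mix(K), with probability at least 1 − δ, ‖(1/N)Σ_{i=1}^N ∇f(w; z_i) − ∇F(w)‖ ≤ (6G/√n)(1 + √(log(K/δ'))) + 2GK/N, where δ' = δ − K(n−1)d_mix(K). -/

import Mathlib

open Finset

/-- The expectation of `φ (z₀, …, z_{n-1})` for a chain with initial weights `ν` and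
transition weights `Q`. -/
noncomputable def chainExp {Ω : Type*} [Fintype Ω] (Q : Ω → Ω → ℝ) :
    (n : ℕ) → (Ω → ℝ) → ((Fin n → Ω) → ℝ) → ℝ
  | 0, _, φ => φ Fin.elim0
  | n + 1, ν, φ => ∑ y, ν y * chainExp Q n (Q y) (fun s => φ (Fin.cons y s))

section ChainExp

variable {Ω : Type*} [Fintype Ω] {Q : Ω → Ω → ℝ}

lemma chainExp_add (n : ℕ) (ν : Ω → ℝ) (φ ψ : (Fin n → Ω) → ℝ) :
    chainExp Q n ν (fun s => φ s + ψ s) = chainExp Q n ν φ + chainExp Q n ν ψ := by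
  induction n generalizing ν with
  | zero => rfl
  | succ n ih => simp only [chainExp, ih, mul_add, sum_add_distrib]

lemma chainExp_mul_left (n : ℕ) (ν : Ω → ℝ) (c : ℝ) (φ : (Fin n → Ω) → ℝ) :
    chainExp Q n ν (fun s => c * φ s) = c * chainExp Q n ν φ := by
  induction n generalizing ν with
  | zero => rfl
  | succ n ih => simp only [chainExp, ih, mul_sum, mul_left_comm]

lemma chainExp_mono (hQ : ∀ x y, 0 ≤ Q x y) (n : ℕ) (ν : Ω → ℝ) (hν : ∀ y, 0 ≤ ν y)
    {φ ψ : (Fin n → Ω) → ℝ} (h : ∀ s, φ s ≤ ψ s) :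
    chainExp Q n ν φ ≤ chainExp Q n ν ψ := by
  induction n generalizing ν with
  | zero => exact h _
  | succ n ih =>
    exact sum_le_sum fun y _ => mul_le_mul_of_nonneg_left (ih _ (hQ y) fun s => h _) (hν y)

lemma chainExp_const (hQ : ∀ x, ∑ y, Q x y = 1) (n : ℕ) (ν : Ω → ℝ) (hν : ∑ y, ν y = 1)
    (c : ℝ) : chainExp Q n ν (fun _ => c) = c := by
  induction n generalizing ν with
  | zero => rfl
  | succ n ih => simp only [chainExp, ih _ (hQ _), ← sum_mul, hν, one_mul]

lemma chainExp_sum (hQ : ∀ x, ∑ y, Q x y = 1) {ι : Type*} (t : Finset ι) (n : ℕ) (ν : Ω → ℝ)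
    (hν : ∑ y, ν y = 1) (φ : ι → (Fin n → Ω) → ℝ) :
    chainExp Q n ν (fun s => ∑ i ∈ t, φ i s) = ∑ i ∈ t, chainExp Q n ν (φ i) := by
  classical
  induction t using Finset.induction_on with
  | empty => simpa using chainExp_const hQ n ν hν 0
  | insert a t ha ih => simp only [sum_insert ha, chainExp_add, ih]

/-- `chainExp` is linear in the initial weights, provided at least one state is sampled. -/
lemma sum_mul_chainExp_succ {ι : Type*} (t : Finset ι) (n : ℕ) (c : ι → ℝ) (ν : ι → Ω → ℝ)
    (φ : (Fin (n + 1) → Ω) → ℝ) :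
    ∑ i ∈ t, c i * chainExp Q (n + 1) (ν i) φ =
      chainExp Q (n + 1) (fun y => ∑ i ∈ t, c i * ν i y) φ := by
  simp only [chainExp, mul_sum, sum_mul, ← mul_assoc]
  exact sum_comm

lemma sum_path_eq_chainExp (m : ℕ) (ν : Ω → ℝ) (φ : (Fin (m + 1) → Ω) → ℝ) :
    ∑ z : Fin (m + 1) → Ω, ν (z 0) * (∏ i : Fin m, Q (z i.castSucc) (z i.succ)) * φ z =
      chainExp Q (m + 1) ν φ := by
  induction m generalizing ν with
  | zero =>
    rw [← (Fin.consEquiv fun _ => Ω).sum_comp, Fintype.sum_prod_type]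
    simp only [chainExp]
    refine sum_congr rfl fun y _ => ?_
    rw [Fintype.sum_unique]
    simp only [Fin.consEquiv, Equiv.coe_fn_mk, Fin.cons_zero, univ_eq_empty, prod_empty, mul_one]
    congr!
  | succ m ih =>
    rw [← (Fin.consEquiv fun _ => Ω).sum_comp, Fintype.sum_prod_type, chainExp]
    refine sum_congr rfl fun y _ => ?_
    rw [← ih, mul_sum]
    refine sum_congr rfl fun s _ => ?_
    simp [Fin.consEquiv, Fin.prod_univ_succ (n := m), mul_assoc]

/-- Sampling a chain with transition matrix `P` at the times `k, k + K, k + 2K, …` gives a chain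
with transition matrix `P ^ K`. -/
lemma chainExp_subsample [DecidableEq Ω] (P : Matrix Ω Ω ℝ) (hP : ∀ x, ∑ y, P x y = 1)
    {K : ℕ} (hK : 1 ≤ K) (m n k : ℕ) (ν : Ω → ℝ) (hν : ∑ y, ν y = 1)
    (ι : Fin n → Fin m) (hι : ∀ j, (ι j : ℕ) = k + j * K) (ψ : (Fin n → Ω) → ℝ) :
    chainExp P m ν (fun s => ψ (fun j => s (ι j))) =
      chainExp (P ^ K) n (fun y => ∑ x, ν x * (P ^ k) x y) ψ := by
  induction m generalizing n k ν with
  | zero =>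
    cases n with
    | zero => exact congrArg ψ (Subsingleton.elim _ _)
    | succ n => exact (ι 0).elim0
  | succ m ih =>
    cases n with
    | zero =>
      rw [show (fun s : Fin (m + 1) → Ω => ψ fun j => s (ι j)) = fun _ => ψ Fin.elim0 from
        funext fun s => congrArg ψ (Subsingleton.elim _ _), chainExp_const hP _ _ hν]
      rfl
    | succ n =>
      cases k with
      | zero =>
        obtain ⟨K, rfl⟩ : ∃ L, K = L + 1 := ⟨K - 1, by omega⟩
        have h0 : ι 0 = 0 := Fin.ext (by simp [hι])
        have hpos : ∀ j : Fin n, ι j.succ ≠ 0 := fun j h => by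
          have := hι j.succ
          rw [h] at this
          simp at this
        have hι' : ∀ j : Fin n, (((ι j.succ).pred (hpos j) : Fin m) : ℕ) = K + j * (K + 1) := by
          intro j
          rw [Fin.val_pred, hι]
          simp only [Fin.val_succ]
          rw [add_mul]
          omega
        have hfun : ∀ (y : Ω) (s : Fin m → Ω),
            (fun j => (Fin.cons y s : Fin (m + 1) → Ω) (ι j)) =
              (Fin.cons y fun j => s ((ι j.succ).pred (hpos j)) : Fin (n + 1) → Ω) := by
          intro y s
          funext j
          refine Fin.cases ?_ (fun j => ?_) j
          · simp [h0]
          · conv_lhs => rw [← Fin.succ_pred (ι j.succ) (hpos j)]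
            simp only [Fin.cons_succ]
        simp only [chainExp, hfun]
        refine sum_congr rfl fun y _ => ?_
        rw [ih n K (P y) (hP y) _ hι' (fun s => ψ (Fin.cons y s))]
        congr 1
        · simp [Matrix.one_apply]
        · congr 1
          funext x
          rw [pow_succ', Matrix.mul_apply]
      | succ k =>
        have hpos : ∀ j, ι j ≠ 0 := fun j h => by
          have := hι j
          rw [h] at this
          simp at this
          omega
        have hι' : ∀ j, (((ι j).pred (hpos j) : Fin m) : ℕ) = k + j * K := by
          intro j
          rw [Fin.val_pred, hι]
          omega
        have hfun : ∀ (y : Ω) (s : Fin m → Ω),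
            (fun j => (Fin.cons y s : Fin (m + 1) → Ω) (ι j)) =
              fun j => s ((ι j).pred (hpos j)) := by
          intro y s
          funext j
          conv_lhs => rw [← Fin.succ_pred (ι j) (hpos j)]
          simp only [Fin.cons_succ]
        change ∑ y, ν y * chainExp P m (P y)
          (fun s => ψ fun j => (Fin.cons y s : Fin (m + 1) → Ω) (ι j)) = _
        simp only [hfun, ih (n + 1) k (P _) (hP _) _ hι' ψ]
        refine (sum_mul_chainExp_succ _ _ _ _ _).trans ?_
        congr 1
        funext x
        simp only [pow_succ', Matrix.mul_apply]

lemma sum_mul_le_add_tv (p q g : Ω → ℝ) (hp : ∑ y, p y = 1) (hq : ∑ y, q y = 1)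
    (hg0 : ∀ y, 0 ≤ g y) (hg1 : ∀ y, g y ≤ 1) :
    ∑ y, p y * g y ≤ ∑ y, q y * g y + 1 / 2 * ∑ y, |p y - q y| := by
  have h : ∑ y, (p y - q y) * (g y - 1 / 2) ≤ ∑ y, 1 / 2 * |p y - q y| := by
    refine sum_le_sum fun y _ => (le_abs_self _).trans ?_
    rw [abs_mul, mul_comm]
    exact mul_le_mul_of_nonneg_right (abs_le.2 ⟨by linarith [hg0 y], by linarith [hg1 y]⟩)
      (abs_nonneg _)
  have h' : ∑ y, (p y - q y) * (g y - 1 / 2) =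
      ∑ y, p y * g y - ∑ y, q y * g y - (∑ y, p y - ∑ y, q y) * (1 / 2) := by
    simp only [← sum_sub_distrib, sum_mul]
    exact sum_congr rfl fun y _ => by ring
  rw [← mul_sum] at h
  rw [h', hp, hq] at h
  linarith

/-- Replacing every transition of a chain by independent draws from `μ` costs `D` in total
variation per transition. -/
lemma chainExp_le_iid_add (hQ0 : ∀ x y, 0 ≤ Q x y) (hQ : ∀ x, ∑ y, Q x y = 1) (μ : Ω → ℝ)
    (hμ0 : ∀ y, 0 ≤ μ y) (hμ : ∑ y, μ y = 1) {D : ℝ}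
    (hD : ∀ x, 1 / 2 * ∑ y, |Q x y - μ y| ≤ D) (n : ℕ) (ν : Ω → ℝ) (hν0 : ∀ y, 0 ≤ ν y)
    (hν : ∑ y, ν y = 1) (φ : (Fin (n + 1) → Ω) → ℝ) (h0 : ∀ s, 0 ≤ φ s) (h1 : ∀ s, φ s ≤ 1) :
    chainExp Q (n + 1) ν φ ≤ ∑ y, ν y * chainExp (fun _ => μ) n μ (fun s => φ (Fin.cons y s))
      + n * D := by
  induction n generalizing ν with
  | zero => simp [chainExp]
  | succ n ih =>
    rw [chainExp]
    have key : ∀ y, chainExp Q (n + 1) (Q y) (fun s => φ (Fin.cons y s)) ≤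
        chainExp (fun _ => μ) (n + 1) μ (fun s => φ (Fin.cons y s)) + (n + 1 : ℕ) * D := by
      intro y
      refine (ih (Q y) (hQ0 y) (hQ y) _ (fun s => h0 _) fun s => h1 _).trans ?_
      rw [chainExp]
      have hm := sum_mul_le_add_tv (Q y) μ
        (fun x => chainExp (fun _ => μ) n μ fun s => φ (Fin.cons y (Fin.cons x s)))
        (hQ y) hμ
        (fun x => by
          have := chainExp_mono (fun _ => hμ0) n μ hμ0 (φ := fun _ => 0)
            (ψ := fun s => φ (Fin.cons y (Fin.cons x s))) fun s => h0 _
          rwa [chainExp_const (fun _ => hμ) n μ hμ] at this)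
        (fun x => by
          have := chainExp_mono (fun _ => hμ0) n μ hμ0 (ψ := fun _ => 1)
            (φ := fun s => φ (Fin.cons y (Fin.cons x s))) fun s => h1 _
          rwa [chainExp_const (fun _ => hμ) n μ hμ] at this)
      have := hD y
      push_cast
      linarith
    calc _ ≤ ∑ y, ν y * (chainExp (fun _ => μ) (n + 1) μ (fun s => φ (Fin.cons y s))
          + (n + 1 : ℕ) * D) :=
          sum_le_sum fun y _ => mul_le_mul_of_nonneg_left (key y) (hν0 y)
      _ = _ := by simp only [mul_add, sum_add_distrib, ← sum_mul, hν, one_mul]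

end ChainExp

lemma exp_le_add_exp_sq (y : ℝ) : Real.exp y ≤ y + Real.exp (y ^ 2) := by
  have h2 := Real.add_one_le_exp (y ^ 2)
  rcases le_or_gt |y| 1 with h | h
  · have := (abs_le.1 (Real.abs_exp_sub_one_sub_id_le h)).2
    linarith
  · rcases lt_abs.1 h with h | h
    · have := Real.exp_le_exp.2 (show y ≤ y ^ 2 by nlinarith)
      linarith
    · have := Real.exp_le_one_iff.2 (show y ≤ 0 by linarith)
      nlinarith

/-- A Hoeffding-type bound for a finitely supported random variable of oscillation at most `c`. -/
lemma sum_mul_exp_le {Ω : Type*} [Fintype Ω] (μ : Ω → ℝ) (hμ0 : ∀ y, 0 ≤ μ y)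
    (hμ : ∑ y, μ y = 1) (g : Ω → ℝ) {c : ℝ} (hg : ∀ x y, |g x - g y| ≤ c) (l : ℝ) :
    ∑ y, μ y * Real.exp (l * g y) ≤ Real.exp (l * ∑ y, μ y * g y + l ^ 2 * c ^ 2) := by
  set e := ∑ y, μ y * g y with he
  have hdev : ∀ x, |g x - e| ≤ c := by
    intro x
    have : g x - e = ∑ y, μ y * (g x - g y) := by
      simp only [mul_sub, sum_sub_distrib, ← sum_mul, hμ, one_mul, he]
    rw [this]
    calc _ ≤ ∑ y, |μ y * (g x - g y)| := abs_sum_le_sum_abs _ _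
      _ ≤ ∑ y, μ y * c := sum_le_sum fun y _ => by
          rw [abs_mul, abs_of_nonneg (hμ0 y)]
          exact mul_le_mul_of_nonneg_left (hg x y) (hμ0 y)
      _ = c := by rw [← sum_mul, hμ, one_mul]
  have hpt : ∀ y, Real.exp (l * g y) ≤
      Real.exp (l * e) * (l * (g y - e) + Real.exp (l ^ 2 * c ^ 2)) := by
    intro y
    have hsq : (l * (g y - e)) ^ 2 ≤ l ^ 2 * c ^ 2 := by
      rw [mul_pow]
      exact mul_le_mul_of_nonneg_left (sq_le_sq.2 ((hdev y).trans (le_abs_self c))) (sq_nonneg l)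
    rw [show l * g y = l * e + l * (g y - e) by ring, Real.exp_add]
    refine mul_le_mul_of_nonneg_left ?_ (Real.exp_pos _).le
    exact (exp_le_add_exp_sq _).trans (by gcongr)
  calc _ ≤ ∑ y, μ y * (Real.exp (l * e) * (l * (g y - e) + Real.exp (l ^ 2 * c ^ 2))) :=
        sum_le_sum fun y _ => mul_le_mul_of_nonneg_left (hpt y) (hμ0 y)
    _ = ∑ y, (Real.exp (l * e) * l * (μ y * g y) +
          Real.exp (l * e) * (Real.exp (l ^ 2 * c ^ 2) - l * e) * μ y) :=
        sum_congr rfl fun y _ => by ring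
    _ = _ := by
        rw [sum_add_distrib, ← mul_sum, ← mul_sum, ← he, hμ, Real.exp_add]
        ring

section Iid

variable {Ω : Type*} [Fintype Ω] {E : Type*} [NormedAddCommGroup E]

lemma chainExp_iid_exp_norm_le (μ : Ω → ℝ) (hμ0 : ∀ y, 0 ≤ μ y) (hμ : ∑ y, μ y = 1)
    (X : Ω → E) {c : ℝ} (hX : ∀ x y, ‖X x - X y‖ ≤ c) (l : ℝ) (n : ℕ) (v : E) :
    chainExp (fun _ => μ) n μ (fun s => Real.exp (l * ‖v + ∑ j, X (s j)‖)) ≤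
      Real.exp (l * chainExp (fun _ => μ) n μ (fun s => ‖v + ∑ j, X (s j)‖)
        + n * (l ^ 2 * c ^ 2)) := by
  induction n generalizing v with
  | zero => simp [chainExp]
  | succ n ih =>
    simp only [chainExp, Fin.sum_univ_succ, Fin.cons_zero, Fin.cons_succ, ← add_assoc]
    set g : Ω → ℝ := fun y => chainExp (fun _ => μ) n μ fun s => ‖v + X y + ∑ j, X (s j)‖
    have hle : ∀ x y, g x - g y ≤ c := by
      intro x y
      have := chainExp_mono (fun _ => hμ0) n μ hμ0
        (φ := fun s => ‖v + X x + ∑ j, X (s j)‖)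
        (ψ := fun s => ‖v + X y + ∑ j, X (s j)‖ + c) fun s => by
          have h := norm_sub_norm_le (v + X x + ∑ j, X (s j)) (v + X y + ∑ j, X (s j))
          rw [show v + X x + ∑ j, X (s j) - (v + X y + ∑ j, X (s j)) = X x - X y by abel] at h
          linarith [hX x y]
      rw [chainExp_add, chainExp_const (fun _ => hμ) n μ hμ] at this
      simp only [g]
      linarith
    have hg : ∀ x y, |g x - g y| ≤ c := fun x y =>
      abs_le.2 ⟨by linarith [hle y x], hle x y⟩
    calc _ ≤ ∑ y, μ y * (Real.exp (l * g y) * Real.exp (n * (l ^ 2 * c ^ 2))) :=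
          sum_le_sum fun y _ => mul_le_mul_of_nonneg_left
            ((ih (v + X y)).trans_eq (Real.exp_add _ _)) (hμ0 y)
      _ = (∑ y, μ y * Real.exp (l * g y)) * Real.exp (n * (l ^ 2 * c ^ 2)) := by
          simp only [sum_mul, mul_assoc]
      _ ≤ Real.exp (l * ∑ y, μ y * g y + l ^ 2 * c ^ 2) * Real.exp (n * (l ^ 2 * c ^ 2)) :=
          mul_le_mul_of_nonneg_right (sum_mul_exp_le μ hμ0 hμ g hg l) (Real.exp_pos _).le
      _ = _ := by
          rw [← Real.exp_add]
          congr 1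
          simp only [g]
          push_cast
          ring

variable [InnerProductSpace ℝ E]

lemma chainExp_iid_norm_sq_le (μ : Ω → ℝ) (hμ0 : ∀ y, 0 ≤ μ y) (hμ : ∑ y, μ y = 1)
    (X : Ω → E) (hmean : ∑ y, μ y • X y = 0) {c : ℝ} (hX : ∀ x, ‖X x‖ ≤ c) (n : ℕ) (v : E) :
    chainExp (fun _ => μ) n μ (fun s => ‖v + ∑ j, X (s j)‖ ^ 2) ≤ ‖v‖ ^ 2 + n * c ^ 2 := by
  induction n generalizing v with
  | zero => simp [chainExp]
  | succ n ih =>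
    simp only [chainExp, Fin.sum_univ_succ, Fin.cons_zero, Fin.cons_succ, ← add_assoc]
    calc _ ≤ ∑ y, μ y * (‖v‖ ^ 2 + 2 * inner ℝ v (X y) + c ^ 2 + n * c ^ 2) := by
          refine sum_le_sum fun y _ => mul_le_mul_of_nonneg_left ((ih _).trans ?_) (hμ0 y)
          rw [norm_add_sq_real]
          have := pow_le_pow_left₀ (norm_nonneg _) (hX y) 2
          linarith
      _ = (∑ y, μ y) * (‖v‖ ^ 2 + c ^ 2 + n * c ^ 2) + 2 * inner ℝ v (∑ y, μ y • X y) := by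
          simp only [inner_sum, inner_smul_right, mul_sum, sum_mul, ← sum_add_distrib]
          exact sum_congr rfl fun y _ => by ring
      _ = _ := by
          rw [hμ, hmean, inner_zero_right]
          push_cast
          ring

lemma chainExp_iid_norm_le (μ : Ω → ℝ) (hμ0 : ∀ y, 0 ≤ μ y) (hμ : ∑ y, μ y = 1)
    (X : Ω → E) (hmean : ∑ y, μ y • X y = 0) {c : ℝ} (hc : 0 < c) (hX : ∀ x, ‖X x‖ ≤ c)
    {n : ℕ} (hn : 0 < n) :
    chainExp (fun _ => μ) n μ (fun s => ‖∑ j, X (s j)‖) ≤ c * √n := by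
  have hs : 0 < √(n : ℝ) := Real.sqrt_pos.2 (by exact_mod_cast hn)
  have hss : √(n : ℝ) ^ 2 = n := Real.sq_sqrt (by positivity)
  set a := c * √n with ha
  have ha0 : 0 < a := by positivity
  have h1 := chainExp_mono (fun _ => hμ0) n μ hμ0
    (φ := fun s => ‖∑ j, X (s j)‖)
    (ψ := fun s => (2 * a)⁻¹ * ‖0 + ∑ j, X (s j)‖ ^ 2 + a / 2) fun s => by
      simp only [zero_add]
      have := two_mul_le_add_sq a ‖∑ j, X (s j)‖
      field_simp
      linarith
  rw [chainExp_add, chainExp_mul_left, chainExp_const (fun _ => hμ) n μ hμ] at h1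
  have h2 := chainExp_iid_norm_sq_le μ hμ0 hμ X hmean hX n 0
  have h3 : (n : ℝ) * c ^ 2 = a ^ 2 := by rw [ha, mul_pow, hss, mul_comm]
  rw [norm_zero, h3] at h2
  have h4 := mul_le_mul_of_nonneg_left h2 (show 0 ≤ (2 * a)⁻¹ by positivity)
  have h5 : (2 * a)⁻¹ * (0 ^ 2 + a ^ 2) = a / 2 := by field_simp; ring
  linarith

/-- Dimension-free concentration of a sum of `n` independent centered vectors. -/
lemma chainExp_iid_tail_le (μ : Ω → ℝ) (hμ0 : ∀ y, 0 ≤ μ y) (hμ : ∑ y, μ y = 1)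
    (X : Ω → E) (hmean : ∑ y, μ y • X y = 0) {c : ℝ} (hX : ∀ x, ‖X x‖ ≤ c)
    (hXX : ∀ x y, ‖X x - X y‖ ≤ c) {n : ℕ} (hn : 0 < n) {L : ℝ} (hL : 0 ≤ L) {T : ℝ}
    (hT : c * √n * (1 + 2 * √L) ≤ T) :
    chainExp (fun _ => μ) n μ (fun s => if T < ‖∑ j, X (s j)‖ then 1 else 0) ≤
      Real.exp (-L) := by
  have hc : 0 ≤ c := by
    by_contra! h
    have : IsEmpty Ω := ⟨fun x => by linarith [norm_nonneg (X x), hX x]⟩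
    simp at hμ
  rcases hc.eq_or_lt with rfl | hc
  · have hX0 : ∀ x, X x = 0 := fun x => norm_le_zero_iff.1 (hX x)
    have hT0 : ¬ T < 0 := by simpa using hT
    simp only [hX0, sum_const_zero, norm_zero, hT0, if_false]
    rw [chainExp_const (fun _ => hμ) n μ hμ]
    exact (Real.exp_pos _).le
  have hs : 0 < √(n : ℝ) := Real.sqrt_pos.2 (by exact_mod_cast hn)
  have hss : √(n : ℝ) ^ 2 = n := Real.sq_sqrt (by positivity)
  have hLs : √L ^ 2 = L := Real.sq_sqrt hL
  set l := √L / (c * √n) with hl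
  have hl0 : 0 ≤ l := by positivity
  have hlc : l * (c * √n) = √L := by rw [hl]; field_simp
  have h1 := chainExp_mono (fun _ => hμ0) n μ hμ0
    (φ := fun s => if T < ‖∑ j, X (s j)‖ then 1 else 0)
    (ψ := fun s => Real.exp (-(l * T)) * Real.exp (l * ‖0 + ∑ j, X (s j)‖)) fun s => by
      simp only [zero_add, ← Real.exp_add]
      split_ifs with h
      · exact Real.one_le_exp (by nlinarith)
      · exact (Real.exp_pos _).le
  rw [chainExp_mul_left] at h1
  have h2 := chainExp_iid_exp_norm_le μ hμ0 hμ X hXX l n 0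
  have h3 := mul_le_mul_of_nonneg_left h2 (Real.exp_pos (-(l * T))).le
  refine h1.trans (h3.trans ?_)
  rw [← Real.exp_add]
  refine Real.exp_le_exp.2 ?_
  simp only [zero_add]
  have h4 := mul_le_mul_of_nonneg_left
    (chainExp_iid_norm_le μ hμ0 hμ X hmean hc hX hn) hl0
  have h5 := mul_le_mul_of_nonneg_left hT hl0
  have h6 : (n : ℝ) * (l ^ 2 * c ^ 2) = L := by
    rw [← hss, ← hLs, ← hlc]; ring
  have h7 : l * (c * √n * (1 + 2 * √L)) = √L + 2 * L := by
    rw [← mul_assoc, hlc, mul_add, mul_one]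
    nlinarith
  linarith

end Iid

lemma sum_range_mul_eq_sum_sum {M : Type*} [AddCommMonoid M] (a : ℕ → M) (K n : ℕ) :
    ∑ i ∈ range (n * K), a i = ∑ k ∈ range K, ∑ j ∈ range n, a (k + j * K) := by
  rw [sum_comm]
  induction n with
  | zero => simp
  | succ n ih =>
    rw [add_mul, one_mul, sum_range_add, ih, sum_range_succ]
    simp only [add_comm]

/-- Splitting a sum into `K` interleaved blocks of length `n` and fewer than `K` leftover terms. -/
lemma norm_sum_le_of_blocks {E : Type*} [SeminormedAddCommGroup E] {N K n : ℕ} (hK : 1 ≤ K)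
    (hn : n = N / K) (a : Fin N → E) {c T : ℝ} (hc : 0 ≤ c) (ha : ∀ i, ‖a i‖ ≤ c)
    (idx : Fin K → Fin n → Fin N) (hidx : ∀ k j, (idx k j : ℕ) = k + j * K)
    (hT : ∀ k, ‖∑ j, a (idx k j)‖ ≤ T) :
    ‖∑ i, a i‖ ≤ K * T + K * c := by
  set b : ℕ → E := fun i => if h : i < N then a ⟨i, h⟩ else 0 with hb
  have hbc : ∀ i, ‖b i‖ ≤ c := by
    intro i
    simp only [hb]
    split_ifs
    · exact ha _
    · simpa using hc
  have hab : ∀ i, a i = b i := fun i => by simp [hb]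
  have hN : N = n * K + N % K := by rw [hn, mul_comm]; exact (Nat.div_add_mod N K).symm
  have hlt := Nat.mod_lt N hK
  have hsum : ∑ i, a i = ∑ k : Fin K, ∑ j, a (idx k j) + ∑ i ∈ range (N % K), b (n * K + i) := by
    calc ∑ i, a i = ∑ i ∈ range N, b i := by simp only [hab, sum_range]
      _ = ∑ i ∈ range (n * K + N % K), b i := by rw [← hN]
      _ = _ := by
        rw [sum_range_add, sum_range_mul_eq_sum_sum, sum_range]
        simp only [sum_range (n := n), hab, hidx]
  rw [hsum]
  refine (norm_add_le _ _).trans (add_le_add ?_ ?_)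
  · refine (norm_sum_le _ _).trans ((sum_le_sum fun k _ => hT k).trans_eq ?_)
    simp
  · refine (norm_sum_le _ _).trans ((sum_le_sum fun i _ => hbc _).trans ?_)
    simp only [sum_const, card_range, nsmul_eq_mul]
    gcongr

/-- Concentration for gradient averages along a stationary finite-state Markov chain.
The chain trajectory `z : Fin (m+1) → Ω` (so `N = m+1` samples) has path probability
`μ(z_0) ∏_i P(z_i, z_{i+1})`; `gf z = ∇f(w; z)` is the stochastic gradient at a fixed `w`
with `‖gf z‖ ≤ G`, and `∇F(w) = Σ_s μ(s) gf(s)`. With `K ∈ [N]`, `n = ⌊N/K⌋` and any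
`δ > K(n-1) d_mix(K)`, the event
`‖(1/N) Σ_i gf(z_i) - ∇F(w)‖ ≤ (6G/√n)(1+√(log(K/δ'))) + 2GK/N` has probability at least
`1 - δ`, where `δ' = δ - K(n-1)d_mix(K)`. -/
theorem markov_gradient_concentration {Ω : Type*} [Fintype Ω] [DecidableEq Ω] [Nonempty Ω]
    {d : ℕ} (P : Matrix Ω Ω ℝ) (μ : Ω → ℝ)
    (hPnn : ∀ i j, 0 ≤ P i j) (hProw : ∀ i, ∑ j, P i j = 1)
    (hμnn : ∀ i, 0 ≤ μ i) (hμsum : ∑ i, μ i = 1)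
    (hstat : ∀ j, ∑ i, μ i * P i j = μ j)
    (gf : Ω → EuclideanSpace ℝ (Fin d)) (G : ℝ) (hG : ∀ z, ‖gf z‖ ≤ G)
    (m K : ℕ) (hK1 : 1 ≤ K) (hK2 : K ≤ m + 1)
    (n : ℕ) (hn : n = (m + 1) / K)
    (dK : ℝ) (hdK : dK = ⨆ z, (1/2 : ℝ) * ∑ y, |(P^K) z y - μ y|)
    (δ δ' : ℝ) (hδ : (K : ℝ) * ((n : ℝ) - 1) * dK < δ)
    (hδ' : δ' = δ - (K : ℝ) * ((n : ℝ) - 1) * dK) :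
    1 - δ ≤ ∑ z : Fin (m+1) → Ω,
      (if ‖((m+1 : ℝ))⁻¹ • ∑ i, gf (z i) - ∑ s, μ s • gf s‖
            ≤ 6 * G / Real.sqrt n * (1 + Real.sqrt (Real.log (K / δ')))
              + 2 * G * K / (m+1)
        then μ (z 0) * ∏ i : Fin m, P (z i.castSucc) (z i.succ) else 0) := by
  classical
  have hweight : ∀ z : Fin (m + 1) → Ω,
      0 ≤ μ (z 0) * ∏ i : Fin m, P (z i.castSucc) (z i.succ) := fun z =>
    mul_nonneg (hμnn _) (prod_nonneg fun i _ => hPnn _ _)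
  rcases le_or_gt 1 δ with hδ1 | hδ1
  · refine (sub_nonpos.2 hδ1).trans (sum_nonneg fun z _ => ?_)
    split_ifs
    exacts [hweight z, le_rfl]
  have hG0 : 0 ≤ G := (norm_nonneg _).trans (hG (Classical.arbitrary Ω))
  have hK0 : (1 : ℝ) ≤ K := by exact_mod_cast hK1
  have hn1 : 1 ≤ n := hn ▸ (Nat.one_le_div_iff hK1).2 hK2
  have hnK : n * K ≤ m + 1 := hn ▸ Nat.div_mul_le_self _ _
  have hn1' : (1 : ℝ) ≤ n := by exact_mod_cast hn1
  have hD : ∀ x, 1 / 2 * ∑ y, |(P ^ K) x y - μ y| ≤ dK := fun x => by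
    rw [hdK]
    exact le_ciSup (f := fun z => (1 / 2 : ℝ) * ∑ y, |(P ^ K) z y - μ y|)
      (Set.finite_range _).bddAbove x
  have hdK0 : 0 ≤ dK :=
    (mul_nonneg (by norm_num) (sum_nonneg fun _ _ => abs_nonneg _)).trans
      (hD (Classical.arbitrary Ω))
  have hδ'0 : 0 < δ' := by rw [hδ']; linarith
  have hδ'1 : δ' ≤ K := by
    have := mul_nonneg (mul_nonneg (by linarith : (0 : ℝ) ≤ K)
      (by linarith : (0 : ℝ) ≤ (n : ℝ) - 1)) hdK0
    linarith
  set L := Real.log (K / δ') with hLdef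
  have hL0 : 0 ≤ L := Real.log_nonneg ((one_le_div hδ'0).2 hδ'1)
  have hexpL : Real.exp (-L) = δ' / K := by
    rw [Real.exp_neg, hLdef, Real.exp_log (by positivity), inv_div]
  have hPstoch : P ∈ Matrix.rowStochastic ℝ Ω :=
    Matrix.mem_rowStochastic_iff_sum.2 ⟨hPnn, hProw⟩
  have hPK := Matrix.mem_rowStochastic_iff_sum.1 (pow_mem hPstoch K)
  have hstatk : ∀ k y, ∑ x, μ x * (P ^ k) x y = μ y := by
    intro k
    induction k with
    | zero => intro y; simp [Matrix.one_apply]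
    | succ k ih =>
      intro y
      simp only [pow_succ', Matrix.mul_apply, mul_sum, ← mul_assoc]
      rw [sum_comm]
      simp only [← sum_mul, hstat, ih]
  set e := ∑ s, μ s • gf s with he
  have hmean : ∑ s, μ s • (gf s - e) = 0 := by
    simp only [smul_sub, sum_sub_distrib, ← sum_smul, hμsum, one_smul, ← he, sub_self]
  have henorm : ‖e‖ ≤ G := by
    refine (norm_sum_le _ _).trans ?_
    calc _ ≤ ∑ s, μ s * G := sum_le_sum fun s _ => by
          rw [norm_smul, Real.norm_of_nonneg (hμnn s)]
          exact mul_le_mul_of_nonneg_left (hG s) (hμnn s)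
      _ = G := by rw [← sum_mul, hμsum, one_mul]
  have hX : ∀ s, ‖gf s - e‖ ≤ 2 * G := fun s =>
    (norm_sub_le _ _).trans (by linarith [hG s])
  have hXX : ∀ s t, ‖(gf s - e) - (gf t - e)‖ ≤ 2 * G := fun s t => by
    rw [sub_sub_sub_cancel_right]
    exact (norm_sub_le _ _).trans (by linarith [hG s, hG t])
  have hidx : ∀ (k : Fin K) (j : Fin n), (k : ℕ) + j * K < m + 1 := fun k j => by
    have h1 : ((j : ℕ) + 1) * K ≤ n * K := Nat.mul_le_mul_right _ j.2
    have h2 := k.2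
    rw [add_mul] at h1
    omega
  set T := 6 * G * √n * (1 + √L) with hTdef
  set bad : Fin K → (Fin (m + 1) → Ω) → ℝ := fun k z =>
    if T < ‖∑ j : Fin n, (gf (z ⟨k + j * K, hidx k j⟩) - e)‖ then 1 else 0 with hbad
  have hbad0 : ∀ k z, 0 ≤ bad k z := fun k z => by
    simp only [hbad]; split_ifs <;> norm_num
  have hbadprob : ∀ k, chainExp P (m + 1) μ (bad k) ≤ δ' / K + ((n : ℝ) - 1) * dK := by
    intro k
    have hsub := chainExp_subsample P hProw hK1 (m + 1) n k μ hμsum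
      (fun j => ⟨k + j * K, hidx k j⟩) (fun j => rfl)
      (fun s => if T < ‖∑ j, (gf (s j) - e)‖ then 1 else 0)
    simp only [hstatk] at hsub
    simp only [hbad]
    rw [hsub, ← hexpL]
    have htail := chainExp_iid_tail_le μ hμnn hμsum (fun s => gf s - e) hmean hX hXX hn1 hL0
      (T := T) (by
        rw [hTdef]
        have h1 : 0 ≤ G * √(n : ℝ) := by positivity
        have h2 := mul_nonneg h1 (Real.sqrt_nonneg L)
        nlinarith)
    obtain ⟨p, rfl⟩ : ∃ p, n = p + 1 := ⟨n - 1, by omega⟩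
    refine (chainExp_le_iid_add hPK.1 hPK.2 μ hμnn hμsum hD p μ hμnn hμsum _
      (fun s => by split_ifs <;> norm_num) (fun s => by split_ifs <;> norm_num)).trans ?_
    rw [chainExp] at htail
    push_cast
    linarith
  set good : (Fin (m + 1) → Ω) → ℝ := fun z =>
    if ‖((m + 1 : ℝ))⁻¹ • ∑ i, gf (z i) - e‖
      ≤ 6 * G / √n * (1 + √L) + 2 * G * K / (m + 1) then 1 else 0 with hgood
  have hgood0 : ∀ z, 0 ≤ good z := fun z => by
    simp only [hgood]; split_ifs <;> norm_num
  have hcover : ∀ z, 1 ≤ good z + ∑ k, bad k z := by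
    intro z
    by_cases hz : ∃ k : Fin K, T < ‖∑ j : Fin n, (gf (z ⟨k + j * K, hidx k j⟩) - e)‖
    · obtain ⟨k, hk⟩ := hz
      have h1 : bad k z = 1 := if_pos hk
      have h2 := single_le_sum (f := fun k => bad k z) (fun k _ => hbad0 k z) (mem_univ k)
      simp only [h1] at h2
      linarith [hgood0 z]
    · push Not at hz
      have hsum := norm_sum_le_of_blocks hK1 hn (fun i => gf (z i) - e)
        (by linarith : (0 : ℝ) ≤ 2 * G) (fun i => hX _) (fun k j => ⟨k + j * K, hidx k j⟩)
        (fun k j => rfl) hz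
      have hg : good z = 1 := by
        refine if_pos ?_
        have hm0 : (0 : ℝ) < m + 1 := by positivity
        have hrew : ((m + 1 : ℝ))⁻¹ • ∑ i, gf (z i) - e =
            ((m + 1 : ℝ))⁻¹ • ∑ i, (gf (z i) - e) := by
          rw [sum_sub_distrib, smul_sub, sum_const, card_univ, Fintype.card_fin,
            ← Nat.cast_smul_eq_nsmul ℝ, smul_smul]
          push_cast
          rw [inv_mul_cancel₀ hm0.ne', one_smul]
        have hs : 0 < √(n : ℝ) := Real.sqrt_pos.2 (by linarith)
        have hT' : T = n * (6 * G / √n * (1 + √L)) := by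
          rw [hTdef]
          nth_rewrite 2 [← Real.mul_self_sqrt (show (0 : ℝ) ≤ n by linarith)]
          field_simp
        have hB : 0 ≤ 6 * G / √n * (1 + √L) := by positivity
        have hnK' : (n : ℝ) * K ≤ m + 1 := by exact_mod_cast hnK
        rw [hrew, norm_smul, norm_inv, Real.norm_of_nonneg hm0.le, inv_mul_le_iff₀ hm0, mul_add,
          mul_div_cancel₀ _ hm0.ne']
        rw [hT'] at hsum
        have := mul_le_mul_of_nonneg_right hnK' hB
        linarith
      linarith [sum_nonneg fun k (_ : k ∈ univ) => hbad0 k z]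
  have htotal := chainExp_mono hPnn (m + 1) μ hμnn hcover
  rw [chainExp_const hProw _ _ hμsum] at htotal
  have hadd := chainExp_add (Q := P) (m + 1) μ good (fun z => ∑ k, bad k z)
  have hsum := chainExp_sum hProw univ (m + 1) μ hμsum bad
  have hbadsum : ∑ k, chainExp P (m + 1) μ (bad k) ≤ δ := by
    refine (sum_le_sum fun k _ => hbadprob k).trans_eq ?_
    rw [sum_const, card_univ, Fintype.card_fin, nsmul_eq_mul, hδ']
    field_simp
    ring
  have hfinal : ∑ z : Fin (m + 1) → Ω,
      (if ‖((m+1 : ℝ))⁻¹ • ∑ i, gf (z i) - e‖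
            ≤ 6 * G / √n * (1 + √L) + 2 * G * K / (m+1)
        then μ (z 0) * ∏ i : Fin m, P (z i.castSucc) (z i.succ) else 0) =
      chainExp P (m + 1) μ good := by
    refine Eq.trans ?_ (sum_path_eq_chainExp m μ good)
    simp only [hgood, mul_ite, mul_one, mul_zero]
  rw [hfinal]
  linarith
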